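/- arXiv:1804.03677 — 2 statements merged into one kernel-verified Lean document; each statement's English description precedes it below -/
import Mathlib

section
/- Let X be an n-dimensional Banach space and (x_j, x_j^*)_{j=1}^N pairs with ‖x_j‖ = ‖x_j^*‖ = x_j^*(x_j) = 1 and frame operator S = Σ x_j^* ⊗ x_j. Then π₂(S) = N/√n if and only if S = (N/n)·I_X. -/
open scoped BigOperators

/-- The 2-summing norm of a continuous linear operator between real normed spaces. -/
noncomputable def pi2 {X Y : Type*} [NormedAddCommGroup X] [NormedSpace ℝ X]
    [NormedAddCommGroup Y] [NormedSpace ℝ Y] (T : X →L[ℝ] Y) : ℝ :=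
  sSup { r : ℝ | ∃ (m : ℕ) (x : Fin m → X),
    (∀ f : X →L[ℝ] ℝ, ∑ i, (f (x i)) ^ 2 ≤ ‖f‖ ^ 2) ∧
    r = Real.sqrt (∑ i, ‖T (x i)‖ ^ 2) }

/-- Compact convex set of positive forms dominated by the dual unit ball. -/
def KK (X : Type*) [NormedAddCommGroup X] [NormedSpace ℝ X] : Set (X → X → ℝ) :=
  {L | (∀ u v w, L (u + v) w = L u w + L v w) ∧ (∀ (c : ℝ) u w, L (c • u) w = c * L u w) ∧
    (∀ u w, L u w = L w u) ∧ (∀ u, 0 ≤ L u u) ∧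
    ∀ (m : ℕ) (y : Fin m → X) (C : ℝ),
      (∀ f : X →L[ℝ] ℝ, ‖f‖ ≤ 1 → ∑ i, (f (y i)) ^ 2 ≤ C) → ∑ i, L (y i) (y i) ≤ C}

section helpers
variable {X : Type*} [NormedAddCommGroup X] [NormedSpace ℝ X]

lemma hom_bound {m : ℕ} {y : Fin m → X} {C : ℝ}
    (h : ∀ f : X →L[ℝ] ℝ, ‖f‖ ≤ 1 → ∑ i, (f (y i)) ^ 2 ≤ C) (g : X →L[ℝ] ℝ) :
    ∑ i, (g (y i)) ^ 2 ≤ ‖g‖ ^ 2 * C := by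
  by_cases hg : g = 0
  · simp [hg]
  have hpos : 0 < ‖g‖ := norm_pos_iff.mpr hg
  have h1 := h (‖g‖⁻¹ • g) (by rw [norm_smul]; simp [hpos.ne'])
  have h2 : ∑ i, ((‖g‖⁻¹ • g) (y i)) ^ 2 = (‖g‖ ^ 2)⁻¹ * ∑ i, (g (y i)) ^ 2 := by
    rw [Finset.mul_sum]
    refine Finset.sum_congr rfl fun i _ => ?_
    simp [mul_pow]
  rw [h2, inv_mul_le_iff₀ (by positivity)] at h1
  exact h1

lemma KK_le_norm {L : X → X → ℝ} (hL : L ∈ KK X) (u : X) : L u u ≤ ‖u‖ ^ 2 := by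
  have := hL.2.2.2.2 1 (fun _ => u) (‖u‖ ^ 2) (by
    intro f hf
    simp only [Finset.univ_unique, Finset.sum_singleton]
    rw [← sq_abs]
    have : |f u| ≤ ‖u‖ := by
      have := f.le_of_opNorm_le hf u
      simpa using this
    gcongr)
  simpa using this

lemma KK_add_right {L : X → X → ℝ} (hL : L ∈ KK X) (u v w : X) :
    L w (u + v) = L w u + L w v := by
  rw [hL.2.2.1 w, hL.1, hL.2.2.1 u, hL.2.2.1 v]

lemma KK_smul_right {L : X → X → ℝ} (hL : L ∈ KK X) (c : ℝ) (u w : X) :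
    L w (c • u) = c * L w u := by
  rw [hL.2.2.1 w, hL.2.1, hL.2.2.1 u]

lemma KK_abs {L : X → X → ℝ} (hL : L ∈ KK X) (u w : X) : |L u w| ≤ (‖u‖ + ‖w‖) ^ 2 := by
  have h1 := KK_le_norm hL (u + w)
  have h2 := KK_le_norm hL (u + (-1 : ℝ) • w)
  have p1 := hL.2.2.2.1 (u + w)
  have p2 := hL.2.2.2.1 (u + (-1 : ℝ) • w)
  have n1 : ‖u + w‖ ≤ ‖u‖ + ‖w‖ := norm_add_le _ _
  have n2 : ‖u + (-1 : ℝ) • w‖ ≤ ‖u‖ + ‖w‖ := by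
    refine (norm_add_le _ _).trans ?_
    simp
  have n1' := pow_le_pow_left₀ (norm_nonneg _) n1 2
  have n2' := pow_le_pow_left₀ (norm_nonneg _) n2 2
  have e := hL.2.2.1 w u
  simp only [hL.1, hL.2.1, KK_add_right hL, KK_smul_right hL] at h1 h2 p1 p2
  rw [abs_le]
  constructor <;> nlinarith

lemma KK_closed : IsClosed (KK X) := by
  have hc : ∀ u w : X, Continuous fun L : X → X → ℝ => L u w := fun u w => by fun_prop
  unfold KK
  simp only [Set.ofPred_and, Set.ofPred_forall]
  refine IsClosed.inter ?_ (IsClosed.inter ?_ (IsClosed.inter ?_ (IsClosed.inter ?_ ?_)))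
  · exact isClosed_iInter fun u => isClosed_iInter fun v => isClosed_iInter fun w =>
      isClosed_eq (by fun_prop) (by fun_prop)
  · exact isClosed_iInter fun u => isClosed_iInter fun v => isClosed_iInter fun w =>
      isClosed_eq (by fun_prop) (by fun_prop)
  · exact isClosed_iInter fun u => isClosed_iInter fun v =>
      isClosed_eq (by fun_prop) (by fun_prop)
  · exact isClosed_iInter fun u => isClosed_le (by fun_prop) (by fun_prop)
  · exact isClosed_iInter fun m => isClosed_iInter fun y => isClosed_iInter fun C =>
      isClosed_iInter fun _ => isClosed_le (by fun_prop) (by fun_prop)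

lemma KK_compact : IsCompact (KK X) := by
  refine IsCompact.of_isClosed_subset (s := Set.univ.pi fun u : X => Set.univ.pi fun w : X =>
    Set.Icc (-((‖u‖ + ‖w‖) ^ 2)) ((‖u‖ + ‖w‖) ^ 2)) ?_ KK_closed ?_
  · exact isCompact_univ_pi fun u => isCompact_univ_pi fun w => isCompact_Icc
  · intro L hL u _ w _
    exact abs_le.mp (KK_abs hL u w)

lemma KK_convex : Convex ℝ (KK X) := by
  intro L hL M hM a b ha hb hab
  refine ⟨?_, ?_, ?_, ?_, ?_⟩
  · intro u v w
    simp only [Pi.add_apply, Pi.smul_apply, smul_eq_mul, hL.1, hM.1]; ring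
  · intro u v w
    simp only [Pi.add_apply, Pi.smul_apply, smul_eq_mul, hL.2.1, hM.2.1]; ring
  · intro u w
    simp only [Pi.add_apply, Pi.smul_apply, smul_eq_mul, hL.2.2.1 u w, hM.2.2.1 u w]
  · intro u
    have := hL.2.2.2.1 u
    have := hM.2.2.2.1 u
    simp only [Pi.add_apply, Pi.smul_apply, smul_eq_mul]; positivity
  · intro m y C h
    have h1 := hL.2.2.2.2 m y C h
    have h2 := hM.2.2.2.2 m y C h
    simp only [Pi.add_apply, Pi.smul_apply, smul_eq_mul, Finset.sum_add_distrib, ← Finset.mul_sum]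
    calc _ ≤ a * C + b * C := by gcongr
      _ = C := by rw [← add_mul, hab, one_mul]

lemma KK_rank_one (f : X →L[ℝ] ℝ) (hf : ‖f‖ ≤ 1) : (fun u w => f u * f w) ∈ KK X := by
  refine ⟨?_, ?_, ?_, ?_, ?_⟩
  · intro u v w; simp; ring
  · intro u v w; simp; ring
  · intro u w; ring
  · intro u; exact mul_self_nonneg _
  · intro m y C h
    simpa [pow_two] using h f hf

lemma KK_sum {ι : Type*} [Fintype ι] (g : ι → X →L[ℝ] ℝ) :
    (fun u w => (1 + ∑ i, ‖g i‖ ^ 2)⁻¹ * ∑ i, g i u * g i w) ∈ KK X := by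
  have hp : 0 < 1 + ∑ i, ‖g i‖ ^ 2 := by positivity
  refine ⟨?_, ?_, ?_, ?_, ?_⟩
  · intro u v w; simp [add_mul, Finset.sum_add_distrib, mul_add]
  · intro c u w
    simp only [map_smul, smul_eq_mul, mul_assoc, ← Finset.mul_sum]; ring
  · intro u w; simp only [mul_comm]
  · intro u
    exact mul_nonneg (by positivity) (Finset.sum_nonneg fun i _ => mul_self_nonneg _)
  · intro m y C h
    have hC : 0 ≤ C := by simpa using h 0 (by simp)
    rw [← Finset.mul_sum, Finset.sum_comm, inv_mul_le_iff₀ hp]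
    calc _ ≤ ∑ i, ‖g i‖ ^ 2 * C := Finset.sum_le_sum fun i _ => by
          simpa [pow_two] using hom_bound h (g i)
      _ ≤ _ := by rw [← Finset.sum_mul]; nlinarith

/-- A member of `KK` as a bilinear form. -/
def KKform (L : X → X → ℝ) (hL : L ∈ KK X) : LinearMap.BilinForm ℝ X :=
  LinearMap.mk₂ ℝ L hL.1 hL.2.1 (fun u v w => KK_add_right hL v w u)
    (fun c u w => KK_smul_right hL c w u)

lemma KK_sum_expand {ι : Type*} [Fintype ι] {L : X → X → ℝ} (hL : L ∈ KK X) (e : ι → X)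
    (ho : ∀ i j, i ≠ j → L (e i) (e j) = 0) (a : ι → ℝ) :
    L (∑ i, a i • e i) (∑ i, a i • e i) = ∑ i, a i ^ 2 * L (e i) (e i) := by
  classical
  change KKform L hL (∑ i, a i • e i) (∑ i, a i • e i) = _
  simp only [map_sum, LinearMap.sum_apply, map_smul, LinearMap.smul_apply, smul_eq_mul]
  refine Finset.sum_congr rfl fun i _ => ?_
  rw [Finset.sum_eq_single i]
  · change _ * (_ * L _ _) = _
    ring
  · intro j _ hj
    have h1 : KKform L hL (e j) (e i) = 0 := ho _ _ hj
    have h2 : KKform L hL (e i) (e j) = 0 := ho _ _ hj.symm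
    simp [h1, h2]
  · simp

lemma KK_orth [FiniteDimensional ℝ X] {n : ℕ} (hn : Module.finrank ℝ X = n)
    {L : X → X → ℝ} (hL : L ∈ KK X) :
    ∃ e : Module.Basis (Fin n) ℝ X, ∀ i j, i ≠ j → L (e i) (e j) = 0 := by
  subst hn
  obtain ⟨e, he⟩ := LinearMap.BilinForm.exists_orthogonal_basis (B := KKform L hL)
    ⟨fun u w => hL.2.2.1 u w⟩
  exact ⟨e, fun i j hij => he hij⟩

/-- The extremal form: the analogue of the John ellipsoid. -/
lemma exists_john [FiniteDimensional ℝ X] {n : ℕ} (hn : Module.finrank ℝ X = n) :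
    ∃ L ∈ KK X, ∀ f : X →L[ℝ] ℝ, ‖f‖ ≤ 1 → ∀ v, (f v) ^ 2 ≤ n * L v v := by
  let b : Module.Basis (Fin n) ℝ X := Module.finBasisOfFinrankEq ℝ X hn
  let D : (X → X → ℝ) → ℝ := fun L => (Matrix.of fun i j => L (b i) (b j)).det
  have hD : Continuous D := by
    apply Continuous.matrix_det
    exact continuous_matrix fun i j => by simp only [Matrix.of_apply]; fun_prop
  let g : Fin n → X →L[ℝ] ℝ := fun i => LinearMap.toContinuousLinearMap (b.coord i)
  have hL0 := KK_sum g
  obtain ⟨L, hL, hmax⟩ := KK_compact.exists_isMaxOn ⟨_, hL0⟩ hD.continuousOn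
  have hpos : 0 < D L := by
    refine lt_of_lt_of_le ?_ (hmax hL0)
    have : (Matrix.of fun i j => (1 + ∑ i, ‖g i‖ ^ 2)⁻¹ * ∑ k, g k (b i) * g k (b j)) =
        (1 + ∑ i, ‖g i‖ ^ 2)⁻¹ • (1 : Matrix (Fin n) (Fin n) ℝ) := by
      ext i j
      simp [g, Matrix.one_apply, Finsupp.single_apply]
    simp only [D, this, Matrix.det_smul, Matrix.det_one]
    positivity
  obtain ⟨e, he⟩ := KK_orth hn hL
  have hch : ∀ M ∈ KK X, (Matrix.of fun i j => M (e i) (e j)).det =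
      (b.toMatrix e).det ^ 2 * D M := by
    intro M hM
    have h := LinearMap.BilinForm.toMatrix_mul_basis_toMatrix b e (KKform M hM)
    have h1 : LinearMap.BilinForm.toMatrix e (KKform M hM) = Matrix.of fun i j => M (e i) (e j) := by
      ext i j; rw [LinearMap.BilinForm.toMatrix_apply]; rfl
    have h2 : LinearMap.BilinForm.toMatrix b (KKform M hM) = Matrix.of fun i j => M (b i) (b j) := by
      ext i j; rw [LinearMap.BilinForm.toMatrix_apply]; rfl
    rw [h1, h2] at h
    rw [← h, Matrix.det_mul, Matrix.det_mul, Matrix.det_transpose]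
    simp only [D]; ring
  have hP : (b.toMatrix e).det ≠ 0 := by
    have := b.toMatrix_mul_toMatrix_flip e
    intro h0
    have h1 := congrArg Matrix.det this
    rw [Matrix.det_mul, h0] at h1
    simp at h1
  let d : Fin n → ℝ := fun i => L (e i) (e i)
  have hdiag : (Matrix.of fun i j => L (e i) (e j)) = Matrix.diagonal d := by
    ext i j
    by_cases hij : i = j
    · subst hij; simp [d]
    · simp [hij, he i j hij]
  have hprod : 0 < ∏ i, d i := by
    rw [← Matrix.det_diagonal, ← hdiag, hch L hL]; positivity
  have hd : ∀ i, 0 < d i := fun i => lt_of_le_of_ne (hL.2.2.2.1 _) fun h =>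
    hprod.ne' (Finset.prod_eq_zero (Finset.mem_univ i) h.symm)
  refine ⟨L, hL, fun f hf v => ?_⟩
  set q : ℝ := ∑ i, f (e i) ^ 2 / d i with hq
  have hs : ∀ s : ℝ, 0 < s → 1 + s * q ≤ (1 + s) ^ n := by
    intro s hs
    have hM := KK_convex hL (KK_rank_one f hf) (a := (1 + s)⁻¹) (b := (1 + s)⁻¹ * s)
      (by positivity) (by positivity) (by field_simp)
    have hle := hmax hM
    have hle' := mul_le_mul_of_nonneg_left hle (sq_nonneg (b.toMatrix e).det)
    rw [← hch _ hM, ← hch _ hL, hdiag, Matrix.det_diagonal] at hle'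
    have hmat : (Matrix.of fun i j => ((1 + s)⁻¹ • L + ((1 + s)⁻¹ * s) • fun u w => f u * f w)
        (e i) (e j)) = (1 + s)⁻¹ • (Matrix.diagonal d *
          (1 + Matrix.replicateCol Unit (fun i => s * f (e i) / d i) *
            Matrix.replicateRow Unit (fun j => f (e j)))) := by
      ext i j
      have hi := (hd i).ne'
      have hij : L (e i) (e j) = Matrix.diagonal d i j := by rw [← hdiag]; rfl
      simp only [Matrix.of_apply, Pi.add_apply, Pi.smul_apply, smul_eq_mul, Matrix.smul_apply,
        Matrix.diagonal_mul, Matrix.add_apply, hij]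
      simp only [Matrix.mul_apply, Matrix.replicateCol_apply,
        Matrix.replicateRow_apply, Finset.univ_unique, Finset.sum_singleton]
      by_cases h : i = j
      · subst h; simp; field_simp
      · simp [h]; field_simp
    rw [hmat, Matrix.det_smul, Matrix.det_mul, Matrix.det_diagonal,
      Matrix.det_one_add_replicateCol_mul_replicateRow, Fintype.card_fin] at hle'
    have hdot : ((fun j => f (e j)) ⬝ᵥ fun i => s * f (e i) / d i) = s * q := by
      simp only [dotProduct, hq, Finset.mul_sum]
      exact Finset.sum_congr rfl fun i _ => by ring
    rw [hdot, inv_pow, inv_mul_le_iff₀ (by positivity)] at hle'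
    exact le_of_mul_le_mul_left (by linarith) hprod
  have hqn : q ≤ n := by
    by_contra hlt
    push Not at hlt
    have hn0 : (0 : ℝ) ≤ n := Nat.cast_nonneg n
    set δ := q - n with hδ
    have hδ0 : 0 < δ := by linarith
    let s : ℝ := min (1 / (n + 1)) (δ / (2 * (n ^ 2 + 1)))
    have hs0 : 0 < s := by positivity
    have hs1 : n * s ≤ 1 := by
      have : s ≤ 1 / (n + 1) := min_le_left _ _
      rw [le_div_iff₀ (by positivity)] at this
      nlinarith
    have hs2 : s * (2 * (n ^ 2 + 1)) ≤ δ := by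
      have : s ≤ δ / (2 * (n ^ 2 + 1)) := min_le_right _ _
      rwa [le_div_iff₀ (by positivity)] at this
    have h1 := hs s hs0
    have h2 : (1 + s) ^ n ≤ Real.exp (n * s) := by
      rw [Real.exp_nat_mul]
      have := Real.add_one_le_exp s
      gcongr
      linarith
    have h3 := (abs_le.mp (Real.abs_exp_sub_one_sub_id_le (x := n * s)
      (by rw [abs_of_nonneg (by positivity)]; exact hs1))).2
    have h4 : s * δ ≤ s * (n ^ 2 * s) := by
      have : q = n + δ := by simp [hδ]
      rw [this] at h1
      nlinarith
    have h5 := le_of_mul_le_mul_left h4 hs0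
    nlinarith
  have hv : v = ∑ i, (e.repr v i) • e i := (e.sum_repr v).symm
  have hLv : L v v = ∑ i, (e.repr v i) ^ 2 * d i := by
    conv_lhs => rw [hv]
    exact KK_sum_expand hL e he _
  have hfv : f v = ∑ i, (e.repr v i) * f (e i) := by
    conv_lhs => rw [hv]
    simp only [map_sum, map_smul, smul_eq_mul]
  have hcs : (f v) ^ 2 ≤ q * L v v := by
    rw [hfv, hLv, hq]
    refine Finset.sum_sq_le_sum_mul_sum_of_sq_eq_mul _ ?_ ?_ ?_
    · intro i _; have := hd i; positivity
    · intro i _; have := hd i; positivity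
    · intro i _; have := (hd i).ne'; field_simp
  exact hcs.trans (mul_le_mul_of_nonneg_right hqn (hL.2.2.2.1 v))

/-- Pietsch domination. -/
lemma exists_pietsch (T : X →L[ℝ] X) (C : ℝ) (hC : 0 < C)
    (h : ∀ (m : ℕ) (y : Fin m → X), (∀ f : X →L[ℝ] ℝ, ∑ i, (f (y i)) ^ 2 ≤ ‖f‖ ^ 2) →
      ∑ i, ‖T (y i)‖ ^ 2 ≤ C) :
    ∃ L ∈ KK X, ∀ v, ‖T v‖ ^ 2 ≤ C * L v v := by
  have hscale : ∀ (m : ℕ) (y : Fin m → X) (W : ℝ), 0 < W →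
      (∀ f : X →L[ℝ] ℝ, ‖f‖ ≤ 1 → ∑ i, (f (y i)) ^ 2 ≤ W) → ∑ i, ‖T (y i)‖ ^ 2 ≤ C * W := by
    intro m y W hW hy
    have hsq : (Real.sqrt W)⁻¹ ^ 2 = W⁻¹ := by rw [inv_pow, Real.sq_sqrt hW.le]
    have := h m (fun i => (Real.sqrt W)⁻¹ • y i) (by
      intro f
      have := hom_bound hy f
      simp only [map_smul, smul_eq_mul, mul_pow, ← Finset.mul_sum, hsq]
      rw [inv_mul_le_iff₀ hW]; linarith)
    simp only [map_smul, norm_smul, mul_pow, ← Finset.mul_sum, Real.norm_eq_abs, sq_abs, hsq] at this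
    rw [inv_mul_le_iff₀ hW] at this
    linarith
  have hfin : ∀ (m : ℕ) (v : Fin m → X), ∃ L ∈ KK X, ∀ i, ‖T (v i)‖ ^ 2 ≤ C * L (v i) (v i) := by
    intro m v
    by_contra hno
    push Not at hno
    let φ : (X → X → ℝ) → Fin m → ℝ := fun L i => C * L (v i) (v i) - ‖T (v i)‖ ^ 2
    have hφ : Continuous φ := by fun_prop
    have hconv : Convex ℝ (φ '' KK X) := by
      rintro _ ⟨L, hL, rfl⟩ _ ⟨M, hM, rfl⟩ a b ha hb hab
      refine ⟨a • L + b • M, KK_convex hL hM ha hb hab, ?_⟩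
      ext i
      have hb' : b = 1 - a := by linarith
      subst hb'
      simp only [φ, Pi.add_apply, Pi.smul_apply, smul_eq_mul]; ring
    obtain ⟨g, u, w, hgu, huw, hgw⟩ := geometric_hahn_banach_compact_closed hconv
      (KK_compact.image hφ) (convex_Ici (0 : Fin m → ℝ)) isClosed_Ici (by
        rw [Set.disjoint_left]
        rintro _ ⟨L, hL, rfl⟩ hz
        obtain ⟨i, hi⟩ := hno L hL
        have := hz i
        simp only [φ, Pi.zero_apply] at this
        linarith)
    have hw : w < 0 := by simpa using hgw 0 (by simp)
    let l : Fin m → ℝ := fun i => g (Pi.single i 1)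
    have hl : ∀ i, 0 ≤ l i := by
      intro i
      by_contra hneg
      push Not at hneg
      have h1 := hgw ((w / l i) • Pi.single i 1) (by
        have : 0 ≤ w / l i := div_nonneg_of_nonpos hw.le hneg.le
        intro j
        by_cases hj : j = i
        · subst hj; simpa using this
        · simp [hj])
      rw [map_smul, smul_eq_mul] at h1
      change w < w / l i * l i at h1
      rw [div_mul_cancel₀ _ hneg.ne] at h1
      exact lt_irrefl _ h1
    have hg : ∀ z : Fin m → ℝ, g z = ∑ i, l i * z i := by
      intro z
      conv_lhs => rw [pi_eq_sum_univ' z]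
      simp only [map_sum, map_smul, smul_eq_mul, l]
      refine Finset.sum_congr rfl fun i _ => ?_
      rw [mul_comm]
    let y : Fin m → X := fun i => Real.sqrt (l i) • v i
    set R : ℝ := ∑ i, ‖T (y i)‖ ^ 2 with hR
    have hR' : R = ∑ i, l i * ‖T (v i)‖ ^ 2 := by
      rw [hR]
      refine Finset.sum_congr rfl fun i _ => ?_
      simp only [y, map_smul, norm_smul, mul_pow, Real.norm_eq_abs, sq_abs, Real.sq_sqrt (hl i)]
    have hkey : ∀ f : X →L[ℝ] ℝ, ‖f‖ ≤ 1 → C * ∑ i, f (y i) ^ 2 ≤ R + u := by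
      intro f hf
      have h1 := hgu _ ⟨_, KK_rank_one f hf, rfl⟩
      rw [hg] at h1
      have h2 : ∑ i, l i * φ (fun u w => f u * f w) i = C * ∑ i, f (y i) ^ 2 - R := by
        rw [hR', Finset.mul_sum, ← Finset.sum_sub_distrib]
        refine Finset.sum_congr rfl fun i _ => ?_
        simp only [φ, y, map_smul, smul_eq_mul, mul_pow, Real.sq_sqrt (hl i)]
        ring
      linarith
    have h0 : 0 ≤ R + u := by simpa using hkey 0 (by simp)
    have hu : u < 0 := huw.trans hw
    have := hscale m y ((R + u / 2) / C) (div_pos (by linarith) hC) (by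
      intro f hf
      rw [le_div_iff₀ hC]
      have := hkey f hf
      linarith)
    rw [mul_div_cancel₀ _ hC.ne'] at this
    linarith
  have := KK_compact.inter_iInter_nonempty (s := KK X)
    (fun v : X => {L : X → X → ℝ | ‖T v‖ ^ 2 ≤ C * L v v})
    (fun v => isClosed_le (by fun_prop) (by fun_prop)) (by
      intro s
      obtain ⟨L, hL, h⟩ := hfin s.card (fun i => (s.equivFin.symm i : X))
      refine ⟨L, hL, ?_⟩
      simp only [Set.mem_iInter]
      intro v hv
      have := h (s.equivFin ⟨v, hv⟩)
      simpa using this)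
  obtain ⟨L, hL, h⟩ := this
  exact ⟨L, hL, fun v => by simpa using Set.mem_iInter.mp h v⟩

/-- The key estimate in an orthogonal basis. -/
lemma key_trace [FiniteDimensional ℝ X] {n : ℕ} (hn : Module.finrank ℝ X = n)
    (T : X →L[ℝ] X) (C : ℝ) (hC : 0 < C) {L : X → X → ℝ} (hL : L ∈ KK X)
    (h : ∀ v, ‖T v‖ ^ 2 ≤ C * L v v) :
    (LinearMap.trace ℝ X (T : X →ₗ[ℝ] X)) ^ 2 ≤ n * C ∧
    ∀ N : ℝ, 0 < N → LinearMap.trace ℝ X (T : X →ₗ[ℝ] X) = N → N ^ 2 = n * C →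
      T = (N / n) • ContinuousLinearMap.id ℝ X := by
  obtain ⟨e, he⟩ := KK_orth hn hL
  let d : Fin n → ℝ := fun i => L (e i) (e i)
  have hd : ∀ i, 0 ≤ d i := fun i => hL.2.2.2.1 _
  let t : Fin n → Fin n → ℝ := fun k i => e.repr (T (e i)) k
  have hTe : ∀ i, T (e i) = ∑ k, t k i • e k := fun i => (e.sum_repr _).symm
  have hz : ∀ i, d i = 0 → T (e i) = 0 := by
    intro i hi
    have := h (e i)
    change _ ≤ C * d i at this
    rw [hi, mul_zero] at this
    have h2 : ‖T (e i)‖ = 0 := by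
      have := norm_nonneg (T (e i)); nlinarith
    exact norm_eq_zero.mp h2
  have htr : LinearMap.trace ℝ X (T : X →ₗ[ℝ] X) = ∑ i, t i i := by
    rw [LinearMap.trace_eq_matrix_trace ℝ e]
    simp [Matrix.trace, LinearMap.toMatrix_apply, t]
  -- the Hilbert-Schmidt bound
  have hq : ∀ f : X →L[ℝ] ℝ, ‖f‖ ≤ 1 → ∑ i, (f ((Real.sqrt (d i))⁻¹ • T (e i))) ^ 2 ≤ C := by
    intro f hf
    set q := ∑ i, (f ((Real.sqrt (d i))⁻¹ • T (e i))) ^ 2 with hqd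
    have hq1 : q = ∑ i, f (T (e i)) ^ 2 / d i := by
      rw [hqd]
      refine Finset.sum_congr rfl fun i _ => ?_
      rw [map_smul, smul_eq_mul, mul_pow, inv_pow, Real.sq_sqrt (hd i)]
      ring
    have hq0 : 0 ≤ q := Finset.sum_nonneg fun i _ => sq_nonneg _
    let v : X := ∑ i, (f (T (e i)) / d i) • e i
    have h1 : L v v = q := by
      rw [hq1]
      refine (KK_sum_expand hL e he _).trans (Finset.sum_congr rfl fun i _ => ?_)
      change _ * d i = _
      by_cases hi : d i = 0
      · simp [hi]
      · field_simp
    have h2 : f (T v) = q := by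
      rw [hq1]
      simp only [v, map_sum, map_smul, smul_eq_mul]
      exact Finset.sum_congr rfl fun i _ => by ring
    have h3 : |f (T v)| ≤ ‖T v‖ := by
      have := f.le_of_opNorm_le hf (T v)
      simpa using this
    have h4 : f (T v) ^ 2 ≤ ‖T v‖ ^ 2 := by
      rw [← sq_abs]; gcongr
    have h5 := h v
    rw [h1] at h5
    rw [h2] at h4
    by_contra hlt
    push Not at hlt
    nlinarith
  have hHS := hL.2.2.2.2 n (fun i => (Real.sqrt (d i))⁻¹ • T (e i)) C hq
  have hHS' : ∑ i, ∑ k, t k i ^ 2 * d k / d i ≤ C := by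
    refine le_of_eq_of_le (Finset.sum_congr rfl fun i _ => ?_) hHS
    rw [hL.2.1, KK_smul_right hL, ← mul_assoc, ← pow_two, inv_pow, Real.sq_sqrt (hd i), hTe i,
      KK_sum_expand hL e he, Finset.mul_sum]
    refine Finset.sum_congr rfl fun k _ => ?_
    change _ = _ * (_ * d k)
    ring
  have hdiagterm : ∀ i, t i i ^ 2 * d i / d i = t i i ^ 2 := by
    intro i
    by_cases hi : d i = 0
    · have : t i i = 0 := by simp [t, hz i hi]
      simp [this]
    · field_simp
  have hterm : ∀ i k, 0 ≤ t k i ^ 2 * d k / d i := fun i k =>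
    div_nonneg (mul_nonneg (sq_nonneg _) (hd k)) (hd i)
  have hrow : ∀ i, t i i ^ 2 ≤ ∑ k, t k i ^ 2 * d k / d i := by
    intro i
    rw [← hdiagterm i]
    exact Finset.single_le_sum (f := fun k => t k i ^ 2 * d k / d i) (fun k _ => hterm i k)
      (Finset.mem_univ i)
  have hsum : ∑ i, t i i ^ 2 ≤ C := (Finset.sum_le_sum fun i _ => hrow i).trans hHS'
  have hcs : (∑ i, t i i) ^ 2 ≤ n * ∑ i, t i i ^ 2 := by
    simpa using sq_sum_le_card_mul_sum_sq (s := Finset.univ) (f := fun i => t i i)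
  have hn0 : (0 : ℝ) ≤ n := Nat.cast_nonneg n
  refine ⟨by rw [htr]; exact hcs.trans (by gcongr), ?_⟩
  intro N hN htrN hNC
  rw [htr] at htrN
  have hnpos : (0 : ℝ) < n := by
    rcases hn0.eq_or_lt with h0 | h0
    · rw [← h0] at hNC; nlinarith
    · exact h0
  have hsumC : ∑ i, t i i ^ 2 = C := by
    refine le_antisymm hsum ?_
    rw [htrN, hNC] at hcs
    exact le_of_mul_le_mul_left hcs hnpos
  have hvar : ∑ i, (t i i - N / n) ^ 2 = 0 := by
    have : ∑ i, (t i i - N / n) ^ 2 = ∑ i, t i i ^ 2 - 2 * (N / n) * ∑ i, t i i + n * (N / n) ^ 2 := by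
      simp only [sub_sq, Finset.sum_add_distrib, Finset.sum_sub_distrib, Finset.mul_sum]
      simp only [Finset.sum_const, Finset.card_univ, Fintype.card_fin, nsmul_eq_mul]
      congr 2
      exact Finset.sum_congr rfl fun i _ => by ring
    rw [this, hsumC, htrN]
    field_simp
    linarith
  have htii : ∀ i, t i i = N / n := by
    intro i
    have := (Finset.sum_eq_zero_iff_of_nonneg (fun i _ => sq_nonneg _)).mp hvar i (Finset.mem_univ i)
    have := pow_eq_zero_iff (two_ne_zero) |>.mp this
    linarith
  have hdpos : ∀ i, 0 < d i := by
    intro i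
    refine lt_of_le_of_ne (hd i) fun h0 => ?_
    have h1 : t i i = 0 := by simp [t, hz i h0.symm]
    rw [htii i] at h1
    exact (div_pos hN hnpos).ne' h1
  have hroweq : ∀ i, t i i ^ 2 = ∑ k, t k i ^ 2 * d k / d i := by
    have h1 : ∑ i, t i i ^ 2 = ∑ i, ∑ k, t k i ^ 2 * d k / d i :=
      le_antisymm (Finset.sum_le_sum fun i _ => hrow i) (by rw [hsumC]; exact hHS')
    intro i
    exact (Finset.sum_eq_sum_iff_of_le (fun i _ => hrow i)).mp h1 i (Finset.mem_univ i)
  have hoff : ∀ i k, k ≠ i → t k i = 0 := by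
    intro i k hki
    have h1 := hroweq i
    rw [← Finset.add_sum_erase _ _ (Finset.mem_univ i), hdiagterm i] at h1
    have h2 : ∑ k ∈ Finset.univ.erase i, t k i ^ 2 * d k / d i = 0 := by linarith
    have h3 := (Finset.sum_eq_zero_iff_of_nonneg (fun k _ => hterm i k)).mp h2 k (by simp [hki])
    have hk := (hdpos k).ne'
    have hi := (hdpos i).ne'
    simpa [hk, hi] using h3
  have hlin : (T : X →ₗ[ℝ] X) = ((N / n) • ContinuousLinearMap.id ℝ X : X →L[ℝ] X) := by
    refine e.ext fun i => ?_
    change T (e i) = (N / n : ℝ) • e i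
    rw [hTe i, Finset.sum_eq_single i, htii i]
    · intro k _ hk; rw [hoff i k hk, zero_smul]
    · simp
  ext v
  exact congrArg (fun A : X →ₗ[ℝ] X => A v) hlin

lemma norm_sq_le_of_dual {v : X} {c : ℝ} (h : ∀ f : X →L[ℝ] ℝ, ‖f‖ ≤ 1 → f v ^ 2 ≤ c) :
    ‖v‖ ^ 2 ≤ c := by
  obtain ⟨f, hf, hfv⟩ := exists_dual_vector'' ℝ v
  have := h f hf
  rw [hfv] at this
  simpa using this

lemma weak_bound [FiniteDimensional ℝ X] {n : ℕ} (hn : Module.finrank ℝ X = n)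
    {m : ℕ} (y : Fin m → X) (hy : ∀ f : X →L[ℝ] ℝ, ∑ i, (f (y i)) ^ 2 ≤ ‖f‖ ^ 2) :
    ∑ i, ‖y i‖ ^ 2 ≤ n := by
  obtain ⟨L, hL, h⟩ := exists_john (X := X) hn
  calc _ ≤ ∑ i, n * L (y i) (y i) := Finset.sum_le_sum fun i _ =>
        norm_sq_le_of_dual fun f hf => h f hf _
    _ = n * ∑ i, L (y i) (y i) := by rw [Finset.mul_sum]
    _ ≤ n * 1 := by
        gcongr
        exact hL.2.2.2.2 m y 1 fun f hf => (hy f).trans (pow_le_one₀ (norm_nonneg _) hf)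
    _ = n := mul_one _

lemma pi2_bdd [FiniteDimensional ℝ X] (T : X →L[ℝ] X) {m : ℕ} (y : Fin m → X)
    (hy : ∀ f : X →L[ℝ] ℝ, ∑ i, (f (y i)) ^ 2 ≤ ‖f‖ ^ 2) :
    Real.sqrt (∑ i, ‖T (y i)‖ ^ 2) ≤ pi2 T := by
  refine le_csSup ⟨Real.sqrt (‖T‖ ^ 2 * Module.finrank ℝ X), ?_⟩ ⟨m, y, hy, rfl⟩
  rintro _ ⟨k, z, hz, rfl⟩
  refine Real.sqrt_le_sqrt ?_
  calc _ ≤ ∑ i, ‖T‖ ^ 2 * ‖z i‖ ^ 2 := Finset.sum_le_sum fun i _ => by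
        rw [← mul_pow]; gcongr; exact T.le_opNorm _
    _ ≤ _ := by
        rw [← Finset.mul_sum]; gcongr; exact weak_bound rfl z hz

lemma pi2_nonneg (T : X →L[ℝ] X) : 0 ≤ pi2 T := by
  refine Real.sSup_nonneg ?_
  rintro _ ⟨k, z, hz, rfl⟩
  exact Real.sqrt_nonneg _

lemma pi2_dom [FiniteDimensional ℝ X] (T : X →L[ℝ] X) {m : ℕ} (y : Fin m → X)
    (hy : ∀ f : X →L[ℝ] ℝ, ∑ i, (f (y i)) ^ 2 ≤ ‖f‖ ^ 2) :
    ∑ i, ‖T (y i)‖ ^ 2 ≤ pi2 T ^ 2 := by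
  have := pi2_bdd T y hy
  exact (Real.sqrt_le_left (pi2_nonneg T)).mp this

end helpers

theorem frame_potential_characterizes_funtf
    {X : Type*} [NormedAddCommGroup X] [NormedSpace ℝ X] [FiniteDimensional ℝ X]
    (n N : ℕ) (hn : Module.finrank ℝ X = n)
    (x : Fin N → X) (f : Fin N → X →L[ℝ] ℝ)
    (hx : ∀ j, ‖x j‖ = 1) (hf : ∀ j, ‖f j‖ = 1) (hpair : ∀ j, f j (x j) = 1)
    (S : X →L[ℝ] X) (hS : ∀ v, S v = ∑ j, f j v • x j) :
    pi2 S = (N : ℝ) / Real.sqrt n ↔ S = ((N : ℝ) / (n : ℝ)) • ContinuousLinearMap.id ℝ X := by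
  have hup : ∀ c : ℝ, 0 ≤ c → pi2 (c • ContinuousLinearMap.id ℝ X) ≤ c * Real.sqrt n := by
    intro c hc
    refine Real.sSup_le ?_ (by positivity)
    rintro _ ⟨k, z, hz, rfl⟩
    refine Real.sqrt_le_iff.mpr ⟨by positivity, ?_⟩
    rw [mul_pow, Real.sq_sqrt (Nat.cast_nonneg n)]
    have := weak_bound hn z hz
    simp only [ContinuousLinearMap.smul_apply, ContinuousLinearMap.id_apply, norm_smul, mul_pow,
      Real.norm_eq_abs, sq_abs, ← Finset.mul_sum]
    gcongr
  rcases Nat.eq_zero_or_pos N with rfl | hN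
  · have hS0 : S = 0 := by ext v; simp [hS]
    have h0 : pi2 S = 0 := by
      refine le_antisymm ?_ (pi2_nonneg S)
      have := hup 0 le_rfl
      simpa [hS0] using this
    rw [h0, hS0]; simp
  have hNr : (0 : ℝ) < N := by exact_mod_cast hN
  have hnpos : (0 : ℝ) < n := by
    have : 0 < n := by
      rw [← hn]
      have : Nontrivial X := ⟨x ⟨0, hN⟩, 0, fun h => by
        have := hx ⟨0, hN⟩
        rw [h] at this; simp at this⟩
      exact Module.finrank_pos
    exact_mod_cast this
  have hsq : 0 < Real.sqrt n := Real.sqrt_pos.mpr hnpos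
  have htr : LinearMap.trace ℝ X (S : X →ₗ[ℝ] X) = N := by
    have : (S : X →ₗ[ℝ] X) = ∑ j, (f j : X →ₗ[ℝ] ℝ).smulRight (x j) := by
      ext v; simp [hS]
    rw [this, map_sum]
    simp [LinearMap.trace_smulRight, hpair]
  constructor
  · intro hpi
    have hC : 0 < pi2 S ^ 2 := by rw [hpi]; positivity
    obtain ⟨L, hL, h⟩ := exists_pietsch S (pi2 S ^ 2) hC fun m y hy => pi2_dom S y hy
    refine (key_trace hn S _ hC hL h).2 N hNr htr ?_
    rw [hpi, div_pow, Real.sq_sqrt hnpos.le]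
    field_simp
  · intro hSc
    refine le_antisymm ?_ ?_
    · have := hup (N / n) (by positivity)
      rw [← hSc] at this
      refine this.trans (le_of_eq ?_)
      have hs := Real.sq_sqrt hnpos.le
      field_simp
      linarith
    · by_contra hlt
      push Not at hlt
      -- pick an intermediate constant
      obtain ⟨c, hc1, hc2⟩ := exists_between hlt
      have hc0 : 0 < c := lt_of_le_of_lt (pi2_nonneg S) hc1
      obtain ⟨L, hL, h⟩ := exists_pietsch S (c ^ 2) (by positivity) fun m y hy =>
        (pi2_dom S y hy).trans (pow_le_pow_left₀ (pi2_nonneg S) hc1.le 2)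
      have h1 := (key_trace hn S _ (by positivity) hL h).1
      rw [htr] at h1
      rw [lt_div_iff₀ hsq] at hc2
      have h2 := pow_lt_pow_left₀ hc2 (by positivity) two_ne_zero
      rw [mul_pow, Real.sq_sqrt hnpos.le] at h2
      linarith
end

section
/- Let X be a finite-dimensional Banach space. If S : X → X is an operator with π₂(S) = 1 and tr(S) = √n, where n = dim X, then S = n^{-1/2} I_X. In other words, the space Π₂(X, X) of 2-summing operators on X is smooth at the identity operator. -/
open scoped BigOperators

/-- The rank one quadratic forms `f ⊗ f` with `f` in the dual unit ball. -/
def pi2Rank {X : Type*} [NormedAddCommGroup X] [NormedSpace ℝ X] :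
    Set (X →L[ℝ] X →L[ℝ] ℝ) :=
  (fun f : X →L[ℝ] ℝ => f.smulRight f) '' Metric.closedBall 0 1

lemma pi2_sum_le {X : Type*} [NormedAddCommGroup X] [NormedSpace ℝ X]
    (S : X →L[ℝ] X) (hS : pi2 S = 1) (m : ℕ) (x : Fin m → X)
    (hx : ∀ f : X →L[ℝ] ℝ, ∑ i, (f (x i)) ^ 2 ≤ ‖f‖ ^ 2) :
    ∑ i, ‖S (x i)‖ ^ 2 ≤ 1 := by
  have hb : BddAbove { r : ℝ | ∃ (m : ℕ) (x : Fin m → X),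
      (∀ f : X →L[ℝ] ℝ, ∑ i, (f (x i)) ^ 2 ≤ ‖f‖ ^ 2) ∧
      r = Real.sqrt (∑ i, ‖S (x i)‖ ^ 2) } := by
    by_contra h
    have := Real.sSup_of_not_bddAbove h
    unfold pi2 at hS
    rw [this] at hS
    norm_num at hS
  have h1 : Real.sqrt (∑ i, ‖S (x i)‖ ^ 2) ≤ 1 := by
    rw [← hS]
    exact le_csSup hb ⟨m, x, hx, rfl⟩
  have := (Real.sqrt_le_iff.mp h1).2
  simpa using this

/-- Scaled version over finite sets with weights. -/
lemma pi2_weighted {X : Type*} [NormedAddCommGroup X] [NormedSpace ℝ X]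
    (S : X →L[ℝ] X) (hS : pi2 S = 1) (F : Finset X) (w : F → ℝ) (hw : ∀ x, 0 ≤ w x)
    (s : ℝ) (hs : 0 < s)
    (h : ∀ f : X →L[ℝ] ℝ, ‖f‖ ≤ 1 → ∑ x, w x * (f x) ^ 2 ≤ s) :
    ∑ x, w x * ‖S x‖ ^ 2 ≤ s := by
  let e := F.equivFin
  have key := pi2_sum_le S hS F.card
    (fun i => Real.sqrt (w (e.symm i) / s) • ((e.symm i : F) : X)) ?_
  · have e1 : ∑ i, ‖S (Real.sqrt (w (e.symm i) / s) • ((e.symm i : F) : X))‖ ^ 2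
        = ∑ x : F, w x / s * ‖S x‖ ^ 2 := by
      rw [← e.symm.sum_comp]
      refine Finset.sum_congr rfl fun i _ => ?_
      rw [map_smul, norm_smul, mul_pow, Real.norm_eq_abs, sq_abs,
        Real.sq_sqrt (div_nonneg (hw _) hs.le)]
    rw [e1] at key
    have e2 : ∑ x : F, w x / s * ‖S x‖ ^ 2 = (∑ x : F, w x * ‖S x‖ ^ 2) / s := by
      rw [Finset.sum_div]
      exact Finset.sum_congr rfl fun i _ => by ring
    rw [e2, div_le_one hs] at key
    exact key
  · intro f
    have e1 : ∑ i, (f (Real.sqrt (w (e.symm i) / s) • ((e.symm i : F) : X))) ^ 2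
        = (∑ x : F, w x * (f x) ^ 2) / s := by
      rw [Finset.sum_div, ← e.symm.sum_comp]
      refine Finset.sum_congr rfl fun i _ => ?_
      rw [map_smul, smul_eq_mul, mul_pow, Real.sq_sqrt (div_nonneg (hw _) hs.le)]
      ring
    rw [e1, div_le_iff₀ hs]
    by_cases hf : f = 0
    · simp [hf]
    have hn : 0 < ‖f‖ := norm_pos_iff.mpr hf
    have := h (‖f‖⁻¹ • f) (by rw [norm_smul, norm_inv, norm_norm, inv_mul_cancel₀ hn.ne'])
    have e3 : ∑ x : F, w x * ((‖f‖⁻¹ • f) x) ^ 2 = (∑ x : F, w x * (f x) ^ 2) / ‖f‖ ^ 2 := by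
      rw [Finset.sum_div]
      refine Finset.sum_congr rfl fun i _ => ?_
      simp only [smul_apply, smul_eq_mul]
      field_simp
    rw [e3, div_le_iff₀ (by positivity)] at this
    linarith

/-- Separation of a compact convex set from an upper orthant. -/
lemma sep_orthant {ι : Type*} [Fintype ι] (A : Set (ι → ℝ)) (hA : IsCompact A)
    (hAc : Convex ℝ A) (y0 : ι → ℝ) (hcon : ∀ a ∈ A, ∃ x, a x < y0 x) :
    ∃ (w : ι → ℝ) (s : ℝ), (∀ x, 0 ≤ w x) ∧ (∀ a ∈ A, ∑ x, w x * a x < s) ∧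
      s < ∑ x, w x * y0 x := by
  classical
  have hdis : Disjoint A (Set.Ici y0) := by
    rw [Set.disjoint_left]
    intro a ha hC
    obtain ⟨x, hlt⟩ := hcon a ha
    exact absurd (hC x) (not_le.mpr hlt)
  obtain ⟨φ, s, t, h1, hst, h2⟩ := geometric_hahn_banach_compact_closed
    hAc hA (convex_Ici y0) isClosed_Ici hdis
  obtain ⟨w, hwdef⟩ : ∃ w : ι → ℝ, ∀ x, φ (Pi.single x 1) = w x := ⟨_, fun _ => rfl⟩
  have hφ : ∀ y, φ y = ∑ x, w x * y x := by
    intro y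
    conv_lhs => rw [pi_eq_sum_univ' y]
    rw [map_sum]
    refine Finset.sum_congr rfl fun x _ => ?_
    rw [map_smul, smul_eq_mul, mul_comm, hwdef]
  have hy0 : t < φ y0 := h2 y0 Set.self_mem_Ici
  have hw : ∀ x, 0 ≤ w x := by
    intro x
    by_contra hneg
    push Not at hneg
    have hmem : y0 + ((φ y0 - t) / (-w x)) • Pi.single x (1 : ℝ) ∈ Set.Ici y0 := by
      intro z
      have : 0 ≤ (φ y0 - t) / (-w x) := div_nonneg (by linarith) (by linarith)
      have h0 : (0:ℝ) ≤ (Pi.single x (1 : ℝ) : ι → ℝ) z := by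
        rw [Pi.single_apply]; split_ifs <;> norm_num
      simp only [Pi.add_apply, Pi.smul_apply, smul_eq_mul]
      nlinarith [mul_nonneg this h0]
    have := h2 _ hmem
    rw [map_add, map_smul, smul_eq_mul, hwdef] at this
    have e : (φ y0 - t) / (-w x) * w x = -(φ y0 - t) := by
      field_simp [hneg.ne]
    rw [e] at this
    linarith
  refine ⟨w, s, hw, fun a ha => ?_, ?_⟩
  · rw [← hφ]; exact h1 a ha
  · rw [← hφ]; exact hst.trans hy0

lemma convex_closure_hull {E : Type*} [NormedAddCommGroup E] [NormedSpace ℝ E] (K : Set E) :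
    Convex ℝ (closure (convexHull ℝ K)) :=
  (convex_convexHull ℝ _).closure

lemma compact_closure_hull {E : Type*} [NormedAddCommGroup E] [NormedSpace ℝ E] [CompleteSpace E]
    (K : Set E) (h : IsCompact K) : IsCompact (closure (convexHull ℝ K)) :=
  TotallyBounded.isCompact_of_isClosed h.totallyBounded.convexHull.closure isClosed_closure

lemma pi2_finite {X : Type*} [NormedAddCommGroup X] [NormedSpace ℝ X] [FiniteDimensional ℝ X]
    (S : X →L[ℝ] X) (hS : pi2 S = 1)
    (hK : IsCompact (closure (convexHull ℝ (pi2Rank (X := X))))) (F : Finset X) :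
    ∃ Q ∈ closure (convexHull ℝ (pi2Rank (X := X))), ∀ x ∈ F, ‖S x‖ ^ 2 ≤ Q x x := by
  by_contra hcon
  push Not at hcon
  obtain ⟨L, hL⟩ : ∃ L : (X →L[ℝ] X →L[ℝ] ℝ) →ₗ[ℝ] (F → ℝ), ∀ Q x, L Q x = Q x x :=
    ⟨{ toFun := fun Q x => Q x x
       map_add' := fun _ _ => rfl
       map_smul' := fun _ _ => rfl }, fun _ _ => rfl⟩
  have hLc : Continuous L := by
    refine continuous_pi fun x => ?_
    simp only [hL]
    fun_prop
  have hconv : Convex ℝ (closure (convexHull ℝ (pi2Rank (X := X)))) :=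
    convex_closure_hull (E := X →L[ℝ] X →L[ℝ] ℝ) _
  have hcomp : IsCompact (L '' closure (convexHull ℝ (pi2Rank (X := X)))) := hK.image hLc
  have hconv2 : Convex ℝ (L '' closure (convexHull ℝ (pi2Rank (X := X)))) :=
    hconv.linear_image L
  obtain ⟨w, s, hw, h1, h2⟩ := sep_orthant _ hcomp hconv2 (fun x : F => ‖S x‖ ^ 2) (by
    rintro _ ⟨Q, hQ, rfl⟩
    obtain ⟨x, hx, hlt⟩ := hcon Q hQ
    refine ⟨⟨x, hx⟩, ?_⟩
    rw [hL]
    exact hlt)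
  have hf : ∀ f : X →L[ℝ] ℝ, ‖f‖ ≤ 1 → ∑ x, w x * (f x) ^ 2 < s := by
    intro f hf
    have hm : f.smulRight f ∈ closure (convexHull ℝ (pi2Rank (X := X))) :=
      subset_closure (subset_convexHull ℝ _ ⟨f, by simpa using hf, rfl⟩)
    have := h1 (L (f.smulRight f)) ⟨_, hm, rfl⟩
    refine lt_of_eq_of_lt (Finset.sum_congr rfl fun x _ => ?_) this
    simp [hL, sq]
  have hs : 0 < s := by simpa using hf 0 (by simp)
  have := pi2_weighted S hS F w hw s hs fun f h => (hf f h).le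
  linarith

lemma pi2_pietsch {X : Type*} [NormedAddCommGroup X] [NormedSpace ℝ X] [FiniteDimensional ℝ X]
    (S : X →L[ℝ] X) (hS : pi2 S = 1) :
    ∃ Q ∈ closure (convexHull ℝ (pi2Rank (X := X))), ∀ x, ‖S x‖ ^ 2 ≤ Q x x := by
  have hK : IsCompact (closure (convexHull ℝ (pi2Rank (X := X)))) := by
    suffices h : IsCompact (pi2Rank (X := X)) from
      compact_closure_hull (E := X →L[ℝ] X →L[ℝ] ℝ) _ h
    have : ProperSpace (X →L[ℝ] ℝ) := FiniteDimensional.proper_real _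
    refine (isCompact_closedBall _ _).image ?_
    have : (fun f : X →L[ℝ] ℝ => f.smulRight f) =
      fun f => ContinuousLinearMap.smulRightL ℝ X (X →L[ℝ] ℝ) f f := by ext; simp
    rw [this]
    fun_prop
  have := hK.inter_iInter_nonempty (fun x : X => {Q : X →L[ℝ] X →L[ℝ] ℝ | ‖S x‖ ^ 2 ≤ Q x x})
    (fun x => isClosed_le continuous_const (by fun_prop)) ?_
  · obtain ⟨Q, hQ, h⟩ := this
    exact ⟨Q, hQ, fun x => by simpa using Set.mem_iInter.mp h x⟩
  · intro F
    obtain ⟨Q, hQ, h⟩ := pi2_finite S hS hK F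
    exact ⟨Q, hQ, by simpa using h⟩

/-- The space of 2-summing operators on a finite-dimensional Banach space is smooth at the
identity: if `π₂(S) = 1` and `tr S = √n` then `S = n^{-1/2} • I`. -/
theorem pi2_smooth_at_identity
    {X : Type*} [NormedAddCommGroup X] [NormedSpace ℝ X] [FiniteDimensional ℝ X]
    (n : ℕ) (hn : Module.finrank ℝ X = n)
    (S : X →L[ℝ] X) (hS : pi2 S = 1)
    (htr : LinearMap.trace ℝ X (S : X →ₗ[ℝ] X) = Real.sqrt n) :
    S = ((Real.sqrt n)⁻¹ : ℝ) • ContinuousLinearMap.id ℝ X := by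
  rcases Nat.eq_zero_or_pos n with h0 | hpos
  · have : Subsingleton X := Module.finrank_zero_iff.mp (hn.trans h0)
    ext x
    exact Subsingleton.elim _ _
  obtain ⟨Q, hQ, hdom⟩ := pi2_pietsch S hS
  have hsymm : ∀ x y, Q x y = Q y x := by
    have : closure (convexHull ℝ (pi2Rank (X := X))) ⊆ {R | ∀ x y, R x y = R y x} := by
      refine closure_minimal (convexHull_min ?_ ?_) ?_
      · rintro _ ⟨f, -, rfl⟩ x y
        simp [mul_comm]
      · intro a ha b hb p q _ _ _ x y
        simp [ha x y, hb x y]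
      · simp only [Set.setOf_forall]
        exact isClosed_iInter fun x => isClosed_iInter fun y =>
          isClosed_eq (by fun_prop) (by fun_prop)
    exact this hQ
  have hpsd : ∀ x, 0 ≤ Q x x := fun x => (sq_nonneg _).trans (hdom x)
  let B : LinearMap.BilinForm ℝ X :=
    LinearMap.mk₂ ℝ (fun x y => Q x y) (by simp) (by simp) (by simp) (by simp)
  have hB : LinearMap.IsSymm B := ⟨fun x y => hsymm x y⟩
  obtain ⟨v, hv⟩ := LinearMap.BilinForm.exists_orthogonal_basis (B := B) hB
  have horth : ∀ i j, i ≠ j → Q (v i) (v j) = 0 := fun i j hij => hv hij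
  set d : Fin (Module.finrank ℝ X) → ℝ := fun i => Q (v i) (v i) with hd
  have hd0 : ∀ i, 0 ≤ d i := fun i => hpsd _
  have hexp : ∀ (c : Fin (Module.finrank ℝ X) → ℝ) j, Q (∑ i, c i • v i) (v j) = c j * d j := by
    intro c j
    simp only [map_sum, map_smul, ContinuousLinearMap.sum_apply, smul_apply,
      smul_eq_mul]
    rw [Finset.sum_eq_single j]
    · intro i _ hij
      rw [horth i j hij, mul_zero]
    · simp
  have hexp2 : ∀ (c : Fin (Module.finrank ℝ X) → ℝ),
      Q (∑ i, c i • v i) (∑ i, c i • v i) = ∑ i, c i ^ 2 * d i := by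
    intro c
    conv_lhs => rw [map_sum (Q (∑ i, c i • v i))]
    refine Finset.sum_congr rfl fun j _ => ?_
    rw [map_smul, hexp, smul_eq_mul]
    ring
  have hkill : ∀ i, d i = 0 → S (v i) = 0 := by
    intro i hi
    have h1 := hdom (v i)
    change _ ≤ d i at h1
    rw [hi] at h1
    have : ‖S (v i)‖ = 0 := by
      have := le_antisymm h1 (sq_nonneg _)
      exact pow_eq_zero_iff (two_ne_zero) |>.mp this
    exact norm_eq_zero.mp this
  -- Hilbert-Schmidt bound
  have hHS : ∑ j, Q (S (v j)) (S (v j)) / d j ≤ 1 := by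
    have : closure (convexHull ℝ (pi2Rank (X := X))) ⊆ {R | ∑ j, R (S (v j)) (S (v j)) / d j ≤ 1} := by
      refine closure_minimal (convexHull_min ?_ ?_) ?_
      · rintro _ ⟨f, hf, rfl⟩
        have hf1 : ‖f‖ ≤ 1 := by simpa using hf
        simp only [Set.mem_setOf_eq, ContinuousLinearMap.smulRight_apply,
          smul_apply, smul_eq_mul]
        set t := ∑ j, f (S (v j)) * f (S (v j)) / d j with ht
        let c : Fin (Module.finrank ℝ X) → ℝ := fun j => f (S (v j)) / d j
        have e1 : f (S (∑ j, c j • v j)) = t := by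
          simp only [map_sum, map_smul, smul_eq_mul, ht, c]
          exact Finset.sum_congr rfl fun j _ => by ring
        have e2 : Q (∑ j, c j • v j) (∑ j, c j • v j) = t := by
          rw [hexp2]
          refine Finset.sum_congr rfl fun j _ => ?_
          by_cases hj : d j = 0
          · simp [hj]
          · simp only [c]; field_simp
        have e3 := hdom (∑ j, c j • v j)
        rw [e2] at e3
        have e4 : ‖f (S (∑ j, c j • v j))‖ ≤ ‖S (∑ j, c j • v j)‖ := by
          refine (f.le_opNorm _).trans ?_
          exact mul_le_of_le_one_left (norm_nonneg _) hf1
        rw [e1, Real.norm_eq_abs] at e4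
        have e5 : t ^ 2 ≤ t := by
          rw [← sq_abs]
          exact (pow_le_pow_left₀ (abs_nonneg _) e4 2).trans e3
        nlinarith
      · intro a ha b hb p q hp hq hpq
        simp only [Set.mem_setOf_eq] at ha hb ⊢
        have : ∑ j, (p • a + q • b) (S (v j)) (S (v j)) / d j
            = p * ∑ j, a (S (v j)) (S (v j)) / d j + q * ∑ j, b (S (v j)) (S (v j)) / d j := by
          rw [Finset.mul_sum, Finset.mul_sum, ← Finset.sum_add_distrib]
          refine Finset.sum_congr rfl fun j _ => ?_
          simp only [ContinuousLinearMap.add_apply, smul_apply, smul_eq_mul]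
          ring
        rw [this]
        nlinarith
      · exact isClosed_le (by fun_prop) continuous_const
    exact this hQ
  have htr2 : ∑ j, v.repr (S (v j)) j = Real.sqrt n := by
    rw [← htr, LinearMap.trace_eq_matrix_trace ℝ v, Matrix.trace]
    exact Finset.sum_congr rfl fun j _ => by simp [LinearMap.toMatrix_apply]
  set l : ℝ := (Real.sqrt n)⁻¹ with hl
  have hsn : 0 < Real.sqrt n := Real.sqrt_pos.mpr (by exact_mod_cast hpos)
  have hlpos : 0 < l := inv_pos.mpr hsn
  have hls : l * Real.sqrt n = 1 := inv_mul_cancel₀ hsn.ne'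
  have hln : n * l ^ 2 = 1 := by
    have : (n : ℝ) = Real.sqrt n ^ 2 := (Real.sq_sqrt (by positivity)).symm
    rw [this, ← mul_pow, mul_comm, hls, one_pow]
  -- termwise nonnegative quantity
  let g : Fin (Module.finrank ℝ X) → ℝ := fun j =>
    Q (S (v j)) (S (v j)) / d j - 2 * l * v.repr (S (v j)) j + l ^ 2
  have hg1 : ∀ j, d j = 0 → 0 < g j := by
    intro j hj
    simp only [g, hj, hkill j hj]
    simp
    positivity
  have hg2 : ∀ j, d j ≠ 0 → g j = Q (S (v j) - l • v j) (S (v j) - l • v j) / d j := by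
    intro j hj
    have e : Q (S (v j)) (v j) = v.repr (S (v j)) j * d j := by
      rw [← hexp (fun i => v.repr (S (v j)) i) j, v.sum_repr]
    have e' : Q (v j) (S (v j)) = v.repr (S (v j)) j * d j := by rw [hsymm, e]
    have e'' : Q (v j) (v j) = d j := rfl
    simp only [g, map_sub, map_smul, ContinuousLinearMap.sub_apply,
      smul_apply, smul_eq_mul, e, e', e'']
    field_simp
    ring
  have hg0 : ∀ j, 0 ≤ g j := by
    intro j
    by_cases hj : d j = 0
    · exact (hg1 j hj).le
    · rw [hg2 j hj]; exact div_nonneg (hpsd _) (hd0 j)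
  have hgs : ∑ j, g j ≤ 0 := by
    simp only [g]
    rw [Finset.sum_add_distrib, Finset.sum_sub_distrib, ← Finset.mul_sum, htr2]
    simp only [Finset.sum_const, Finset.card_univ, Fintype.card_fin, nsmul_eq_mul, hn, hln]
    linarith
  have hgz : ∀ j, g j = 0 := by
    intro j
    exact (Finset.sum_eq_zero_iff_of_nonneg fun i _ => hg0 i).mp
      (le_antisymm hgs (Finset.sum_nonneg fun i _ => hg0 i)) j (Finset.mem_univ j)
  have hdne : ∀ j, d j ≠ 0 := fun j hj => (hg1 j hj).ne' (hgz j)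
  have hnd : ∀ y, Q y y = 0 → y = 0 := by
    intro y hy
    rw [← v.sum_repr y, hexp2] at hy
    have := (Finset.sum_eq_zero_iff_of_nonneg
      fun i _ => mul_nonneg (sq_nonneg _) (hd0 i)).mp hy
    apply v.repr.map_eq_zero_iff.mp
    ext j
    have := this j (Finset.mem_univ j)
    simpa [hdne j] using this
  have hfin : ∀ j, S (v j) = l • v j := by
    intro j
    have := hgz j
    rw [hg2 j (hdne j), div_eq_zero_iff] at this
    exact sub_eq_zero.mp (hnd _ (this.resolve_right (hdne j)))
  apply ContinuousLinearMap.coe_injective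
  apply v.ext
  intro j
  simpa using hfin j
end
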